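/- arXiv:1210.0352 — 2 statements merged into one kernel-verified Lean document; each statement's English description precedes it below -/
import Mathlib

section
/- If C_p(X \ E) = 0 (which forces X to be bounded), then the constant function 1 belongs to N^{1,p}_0(E), and consequently cap_p(A,E) = 0 for every set A ⊂ E. -/
open MeasureTheory Metric Set Filter
open scoped ENNReal NNReal Topology

noncomputable section

variable {X : Type*} [MetricSpace X] [MeasurableSpace X] [BorelSpace X]

/-- A nonconstant, compact, rectifiable curve in `X`, parameterized by arc length on
`[0, len]`. The arc-length parameterization is expressed by requiring that the length
(total variation) of the curve on each subinterval `[s, t]` equals `t - s`. -/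
structure Curve (X : Type*) [MetricSpace X] where
  len : ℝ
  len_pos : 0 < len
  toFun : ℝ → X
  continuousOn : ContinuousOn toFun (Set.Icc 0 len)
  arclength : ∀ s t : ℝ, s ∈ Set.Icc 0 len → t ∈ Set.Icc 0 len → s ≤ t →
    eVariationOn toFun (Set.Icc s t) = ENNReal.ofReal (t - s)
  nonconstant : ∃ s ∈ Set.Icc 0 len, ∃ t ∈ Set.Icc 0 len, toFun s ≠ toFun t

/-- The curve integral `∫_γ g ds` of a nonnegative function along an arc-length
parameterized curve. -/
def Curve.integral (γ : Curve X) (g : X → ℝ≥0∞) : ℝ≥0∞ :=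
  ∫⁻ t in Set.Icc (0 : ℝ) γ.len, g (γ.toFun t)

/-- `|a - b|` with the convention that it is `∞` whenever both `a` and `b` are infinite. -/
def ugDiff (a b : EReal) : ℝ≥0∞ :=
  if a.abs = ⊤ ∨ b.abs = ⊤ then ⊤ else (a - b).abs

/-- The upper gradient inequality for `f` and `g` along the curve `γ`. -/
def UGOn (f : X → EReal) (g : X → ℝ≥0∞) (γ : Curve X) : Prop :=
  ugDiff (f (γ.toFun 0)) (f (γ.toFun γ.len)) ≤ γ.integral g

/-- A curve family has zero `p`-modulus. -/
def ZeroModulus (p : ℝ) (μ : Measure X) (Γ : Set (Curve X)) : Prop :=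
  ∃ ρ : X → ℝ≥0∞, Measurable ρ ∧ (∫⁻ x, ρ x ^ p ∂μ) < ⊤ ∧ ∀ γ ∈ Γ, γ.integral ρ = ⊤

/-- `g` is an upper gradient of `f`. -/
def IsUpperGradient (f : X → EReal) (g : X → ℝ≥0∞) : Prop :=
  Measurable g ∧ ∀ γ : Curve X, UGOn f g γ

/-- `g` is a `p`-weak upper gradient of `f`: the upper gradient inequality holds for
`p`-almost every curve. -/
def IsWeakUpperGradient (p : ℝ) (μ : Measure X) (f : X → EReal) (g : X → ℝ≥0∞) : Prop :=
  Measurable g ∧ ZeroModulus p μ {γ : Curve X | ¬ UGOn f g γ}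

/-- The energy `∫_X g_u^p dμ` of the minimal `p`-weak upper gradient of `u`, expressed as
the infimum of `∫_X g^p dμ` over all `p`-weak upper gradients `g` of `u`
(`= ∞` if `u` has no `p`-weak upper gradient). -/
def gradEnergy (p : ℝ) (μ : Measure X) (u : X → EReal) : ℝ≥0∞ :=
  ⨅ (g : X → ℝ≥0∞) (_ : IsWeakUpperGradient p μ u g), ∫⁻ x, g x ^ p ∂μ

/-- The Newtonian energy `‖u‖_{N^{1,p}(X)}^p = ∫_X |u|^p dμ + ∫_X g_u^p dμ`. -/
def newtonianEnergy (p : ℝ) (μ : Measure X) (u : X → EReal) : ℝ≥0∞ :=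
  (∫⁻ x, (u x).abs ^ p ∂μ) + gradEnergy p μ u

/-- Membership in the Newtonian space `N^{1,p}(X)` (measurability is with respect to the
completion of the Borel σ-algebra, i.e. a.e.-measurability). -/
def MemNewtonian (p : ℝ) (μ : Measure X) (u : X → EReal) : Prop :=
  AEMeasurable u μ ∧ newtonianEnergy p μ u < ⊤

/-- Membership in `N^{1,p}_0(E)`, members being regarded as functions on all of `X`
that vanish outside `E`. -/
def MemNewtonian0 (p : ℝ) (μ : Measure X) (E : Set X) (u : X → EReal) : Prop :=
  MemNewtonian p μ u ∧ ∀ x ∉ E, u x = 0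

/-- The Sobolev capacity `C_p(A)`. -/
def sobolevCapacity (p : ℝ) (μ : Measure X) (A : Set X) : ℝ≥0∞ :=
  ⨅ (u : X → EReal) (_ : MemNewtonian p μ u ∧ ∀ x ∈ A, u x = 1), newtonianEnergy p μ u

/-- The variational capacity `cap_p(A, E)`. -/
def varCapacity (p : ℝ) (μ : Measure X) (A E : Set X) : ℝ≥0∞ :=
  ⨅ (u : X → EReal) (_ : MemNewtonian0 p μ E u ∧ ∀ x ∈ A, 1 ≤ u x), gradEnergy p μ u

/-- A function is quasicontinuous if outside open sets of arbitrarily small Sobolev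
capacity it is real-valued and continuous. -/
def QuasicontinuousFun (p : ℝ) (μ : Measure X) (u : X → EReal) : Prop :=
  ∀ ε : ℝ≥0∞, 0 < ε → ∃ G : Set X, IsOpen G ∧ sobolevCapacity p μ G < ε ∧
    (∀ x ∈ Gᶜ, u x ≠ ⊤ ∧ u x ≠ ⊥) ∧ ContinuousOn u Gᶜ

/-- The capacity `~cap_p(A,E)`: the infimum of `cap_p(G,E)` over all relatively open
subsets `G` of `E` containing `A`. -/
def varCapacityT (p : ℝ) (μ : Measure X) (A E : Set X) : ℝ≥0∞ :=
  ⨅ (G : Set X) (_ : A ⊆ G ∧ G ⊆ E ∧ ∃ U : Set X, IsOpen U ∧ G = U ∩ E),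
    varCapacity p μ G E

/-- The restriction of a curve to a nondegenerate subinterval `[a, b]`. -/
def Curve.subcurve (γ : Curve X) (a b : ℝ) (ha : 0 ≤ a) (hab : a < b) (hb : b ≤ γ.len) :
    Curve X where
  len := b - a
  len_pos := sub_pos.2 hab
  toFun t := γ.toFun (a + t)
  continuousOn := γ.continuousOn.comp (by fun_prop)
    fun t ht => ⟨by linarith [ht.1], by linarith [ht.2]⟩
  arclength s t hs ht hst := by
    have h1 := eVariationOn.comp_eq_of_monotoneOn γ.toFun (fun t : ℝ => a + t) (t := Icc s t)
      (fun x _ y _ hxy => by simpa using hxy)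
    rw [image_const_add_Icc] at h1
    refine h1.trans ?_
    rw [γ.arclength (a + s) (a + t) ⟨by linarith [hs.1], by linarith [hs.2]⟩
      ⟨by linarith [ht.1], by linarith [ht.2]⟩ (by linarith)]
    congr 1
    ring
  nonconstant := by
    by_contra! hc
    have h1 := γ.arclength a b ⟨ha, by linarith⟩ ⟨by linarith, hb⟩ hab.le
    rw [eVariationOn.constant_on] at h1
    · exact (ENNReal.ofReal_pos.2 (sub_pos.2 hab)).ne h1
    · rintro _ ⟨s, hs, rfl⟩ _ ⟨t, ht, rfl⟩
      have := hc (s - a) ⟨by linarith [hs.1], by linarith [hs.2]⟩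
        (t - a) ⟨by linarith [ht.1], by linarith [ht.2]⟩
      simpa using this

theorem Curve.integral_subcurve_le {Y : Type*} [MetricSpace Y] (γ : Curve Y) (a b : ℝ)
    (ha : 0 ≤ a) (hab : a < b) (hb : b ≤ γ.len) (g : Y → ℝ≥0∞) :
    (γ.subcurve a b ha hab hb).integral g ≤ γ.integral g := by
  have h1 := (measurePreserving_add_left (volume : Measure ℝ) a).setLIntegral_comp_emb
    (measurableEmbedding_addLeft a) (fun t => g (γ.toFun t)) (Icc 0 (b - a))
  rw [image_const_add_Icc] at h1
  refine (le_of_eq h1).trans (lintegral_mono_set (Icc_subset_Icc ?_ ?_)) <;> linarith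

theorem Curve.aemeasurable_comp (γ : Curve X) {g : X → ℝ≥0∞} (hg : Measurable g) :
    AEMeasurable (fun t => g (γ.toFun t)) (volume.restrict (Icc 0 γ.len)) :=
  hg.comp_aemeasurable (γ.continuousOn.aemeasurable measurableSet_Icc)

theorem EReal.abs_one : (1 : EReal).abs = 1 := by
  rw [← EReal.coe_one, EReal.abs_def]
  simp

theorem ugDiff_comm (a b : EReal) : ugDiff a b = ugDiff b a := by
  simp only [ugDiff, or_comm (a := b.abs = ⊤)]
  split_ifs with h
  · rfl
  · rw [← EReal.abs_neg, EReal.neg_sub]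
    · rw [add_comm, sub_eq_add_neg]
    · left; rintro rfl; simp at h
    · left; rintro rfl; simp at h

theorem one_le_abs_add_of_ugDiff_le {b : EReal} {I : ℝ≥0∞} (h : ugDiff 1 b ≤ I) :
    1 ≤ b.abs + I := by
  refine le_trans ?_ (add_le_add_right h _)
  unfold ugDiff
  split_ifs with hb
  · simp
  · induction b with
    | bot => simp at hb
    | top => simp at hb
    | coe r =>
      rw [← EReal.coe_one, ← EReal.coe_sub, EReal.abs_def, EReal.abs_def,
        ← ENNReal.ofReal_add (abs_nonneg _) (abs_nonneg _), ENNReal.one_le_ofReal]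
      have := le_abs_self r
      have := le_abs_self (1 - r)
      linarith

theorem exists_measurable_ge_ae_eq {α : Type*} [MeasurableSpace α] {ν : Measure α}
    {f : α → ℝ≥0∞} (hf : AEMeasurable f ν) :
    ∃ g : α → ℝ≥0∞, Measurable g ∧ f ≤ g ∧ g =ᵐ[ν] f := by
  set N := toMeasurable ν {x | f x ≠ hf.mk f x} with hN
  have hN0 : ν N = 0 := by
    rw [hN, measure_toMeasurable]
    exact hf.ae_eq_mk
  refine ⟨fun x => hf.mk f x + N.indicator (fun _ => ⊤) x,
    hf.measurable_mk.add (measurable_const.indicator (measurableSet_toMeasurable _ _)), ?_, ?_⟩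
  · intro x
    by_cases hx : x ∈ N
    · simp [hx]
    · have : f x = hf.mk f x := by
        by_contra hne
        exact hx (subset_toMeasurable ν _ hne)
      simp [hx, this]
  · filter_upwards [hf.ae_eq_mk, measure_eq_zero_iff_ae_notMem.1 hN0] with x hx hxN
    simp [hxN, hx]

theorem UGOn.mono {Y : Type*} [MetricSpace Y] {f : Y → EReal} {g k : Y → ℝ≥0∞}
    {γ : Curve Y} (h : UGOn f g γ) (hgk : g ≤ k) : UGOn f k γ :=
  le_trans h (lintegral_mono fun _ => hgk _)

theorem EReal.measurable_abs : Measurable EReal.abs :=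
  EReal.measurable_of_measurable_real <| by
    simp only [EReal.abs_def]
    fun_prop

/-- A set of zero Sobolev capacity admits test functions which, together with a weak upper
gradient, are dominated by a Borel function of small `L^p` norm. -/
theorem exists_test_of_sobolevCapacity_eq_zero {Y : Type*} [MetricSpace Y]
    [MeasurableSpace Y] {p : ℝ} {μ : Measure Y} {A : Set Y}
    (h : sobolevCapacity p μ A = 0) {ε : ℝ≥0∞} (hε : 0 < ε) :
    ∃ (u : Y → EReal) (k : Y → ℝ≥0∞), (∀ x ∈ A, u x = 1) ∧ (∀ x, (u x).abs ≤ k x) ∧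
      IsWeakUpperGradient p μ u k ∧ ∫⁻ x, k x ^ p ∂μ < ε := by
  have h1 : sobolevCapacity p μ A < ε / 2 := h ▸ ENNReal.half_pos hε.ne'
  simp only [sobolevCapacity, iInf_lt_iff] at h1
  obtain ⟨u, ⟨hu, huA⟩, huε⟩ := h1
  have h2 : gradEnergy p μ u < ε / 2 := le_add_self.trans_lt huε
  simp only [gradEnergy, iInf_lt_iff] at h2
  obtain ⟨g, ⟨hgm, ρ, hρm, hρ, hρtop⟩, hgε⟩ := h2
  obtain ⟨v, hvm, huv, hvu⟩ := exists_measurable_ge_ae_eq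
    (f := fun x => (u x).abs) (ν := μ) (EReal.measurable_abs.comp_aemeasurable hu.1)
  refine ⟨u, v ⊔ g, huA, fun x => (huv x).trans le_sup_left,
    ⟨hvm.sup hgm, ρ, hρm, hρ, fun γ hγ => hρtop γ fun hug => hγ (hug.mono le_sup_right)⟩, ?_⟩
  have hvε : ∫⁻ x, v x ^ p ∂μ < ε / 2 := by
    refine lt_of_le_of_lt (le_of_eq ?_) (le_self_add.trans_lt huε)
    refine lintegral_congr_ae ?_
    filter_upwards [hvu] with x hx
    rw [hx]
  calc ∫⁻ x, (v ⊔ g) x ^ p ∂μ ≤ ∫⁻ x, (v x ^ p + g x ^ p) ∂μ := by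
        refine lintegral_mono fun x => ?_
        rcases le_total (v x) (g x) with hx | hx <;> simp [hx]
    _ = ∫⁻ x, v x ^ p ∂μ + ∫⁻ x, g x ^ p ∂μ := lintegral_add_left (hvm.pow_const p) _
    _ < ε / 2 + ε / 2 := ENNReal.add_lt_add hvε hgε
    _ = ε := ENNReal.add_halves ε

/-- Almost no curve has an endpoint in a set of zero Sobolev capacity. -/
theorem zeroModulus_endpoint_of_sobolevCapacity_eq_zero {p : ℝ} (hp : 1 ≤ p) {μ : Measure X}
    {A : Set X} (h : sobolevCapacity p μ A = 0) :
    ZeroModulus p μ {γ : Curve X | γ.toFun 0 ∈ A ∨ γ.toFun γ.len ∈ A} := by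
  have hp0 : 0 < p := by linarith
  obtain ⟨ε, hε, hεsum⟩ := ENNReal.exists_pos_sum_of_countable' (ε := 1) one_ne_zero ℕ
  choose u k huA huk hk hkε using
    fun j => exists_test_of_sobolevCapacity_eq_zero h (hε j)
  choose hkm ρ hρm hρ hρtop using hk
  obtain ⟨c, hc, hcsum⟩ := ENNReal.exists_pos_tsum_mul_lt_of_countable (ε := 1) one_ne_zero
    (fun j => ∫⁻ x, ρ j x ^ p ∂μ) (fun j => (hρ j).ne)
  set R : X → ℝ≥0∞ := fun x => (∑' j, k j x ^ p) + ∑' j, ρ j x ^ p * c j with hR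
  have hRm : Measurable R := by fun_prop
  have hRp : ∀ x, (R x ^ p⁻¹) ^ p = R x := fun x => ENNReal.rpow_inv_rpow hp0.ne' _
  refine ⟨fun x => R x ^ p⁻¹, by fun_prop, ?_, ?_⟩
  · simp_rw [hRp, hR]
    rw [lintegral_add_left (by fun_prop), lintegral_tsum (fun j => by fun_prop),
      lintegral_tsum (fun j => by fun_prop)]
    refine ENNReal.add_lt_top.2
      ⟨(ENNReal.tsum_le_tsum fun j => (hkε j).le).trans_lt (hεsum.trans ENNReal.one_lt_top), ?_⟩
    refine lt_of_eq_of_lt ?_ (hcsum.trans ENNReal.one_lt_top)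
    congr 1 with j
    rw [lintegral_mul_const _ (by fun_prop)]
  · intro γ hγ
    by_contra hfin
    have hkR : ∀ j x, k j x ≤ R x ^ p⁻¹ := fun j x => by
      rw [ENNReal.le_rpow_inv_iff hp0]
      exact (ENNReal.le_tsum (f := fun j => k j x ^ p) j).trans le_self_add
    have hρfin : ∀ j, γ.integral (ρ j) ≠ ⊤ := fun j htop => by
      have h1 : ∀ x, (c j : ℝ≥0∞) ^ p⁻¹ * ρ j x ≤ R x ^ p⁻¹ := fun x => by
        rw [ENNReal.le_rpow_inv_iff hp0, ENNReal.mul_rpow_of_nonneg _ _ hp0.le,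
          ENNReal.rpow_inv_rpow hp0.ne', mul_comm]
        exact (ENNReal.le_tsum (f := fun j => ρ j x ^ p * c j) j).trans le_add_self
      have h2 : (c j : ℝ≥0∞) ^ p⁻¹ * γ.integral (ρ j) ≤ γ.integral (fun x => R x ^ p⁻¹) := by
        rw [Curve.integral, ← lintegral_const_mul' _ _ (by simp [hp0.le])]
        exact lintegral_mono fun t => h1 _
      rw [htop, ENNReal.mul_top (by simp [ENNReal.rpow_eq_zero_iff, (hc j).ne'])] at h2
      exact hfin (top_le_iff.1 h2)
    have hsub : ∀ j a b (ha : 0 ≤ a) (hab : a < b) (hb : b ≤ γ.len),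
        ugDiff (u j (γ.toFun a)) (u j (γ.toFun b)) ≤ γ.integral (k j) := by
      intro j a b ha hab hb
      have h1 : UGOn (u j) (k j) (γ.subcurve a b ha hab hb) := by
        by_contra hn
        refine hρfin j (top_le_iff.1 ?_)
        rw [← hρtop j _ hn]
        exact γ.integral_subcurve_le ..
      refine le_trans (le_of_eq ?_) (h1.trans (γ.integral_subcurve_le ..))
      simp [Curve.subcurve]
    have hpt : ∀ j, ∀ t ∈ Icc 0 γ.len, 1 ≤ k j (γ.toFun t) + γ.integral (k j) := by
      intro j t ht
      by_cases htA : γ.toFun t ∈ A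
      · have := huk j (γ.toFun t)
        rw [huA j _ htA] at this
        exact le_trans (by simpa [EReal.abs_one] using this) le_self_add
      · refine le_trans (one_le_abs_add_of_ugDiff_le (b := u j (γ.toFun t))
          (I := γ.integral (k j)) ?_) (add_le_add_left (huk j _) _)
        rcases hγ with h0 | hl
        · have htpos : 0 < t := lt_of_le_of_ne ht.1 (by rintro rfl; exact htA h0)
          simpa [huA j _ h0] using hsub j 0 t le_rfl htpos ht.2
        · have htlt : t < γ.len := lt_of_le_of_ne ht.2 (by rintro rfl; exact htA hl)
          rw [ugDiff_comm]
          simpa [huA j _ hl] using hsub j t γ.len ht.1 htlt le_rfl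
    have hlim : Tendsto (fun j => γ.integral (k j)) atTop (𝓝 0) := by
      have h1 := tendsto_lintegral_of_dominated_convergence'
        (μ := volume.restrict (Icc 0 γ.len)) (F := fun j t => k j (γ.toFun t)) (f := fun _ => 0)
        (fun t => R (γ.toFun t) ^ p⁻¹) (fun j => γ.aemeasurable_comp (hkm j))
        (fun j => Eventually.of_forall fun t => hkR j _) hfin ?_
      · simpa [Curve.integral] using h1
      · have hm : Measurable fun x => R x ^ p⁻¹ := by fun_prop
        filter_upwards [ae_lt_top' (γ.aemeasurable_comp hm) hfin] with t ht
        have h2 : ∑' j, k j (γ.toFun t) ^ p ≠ ⊤ := by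
          have h3 : R (γ.toFun t) ≠ ⊤ := by
            intro h4
            simp [h4, hp0] at ht
          exact ne_top_of_le_ne_top h3 le_self_add
        have h5 := (ENNReal.tendsto_atTop_zero_of_tsum_ne_top h2).ennrpow_const p⁻¹
        simpa [ENNReal.rpow_rpow_inv hp0.ne', ENNReal.zero_rpow_of_pos, hp0] using h5
    have hint : ∀ j, ENNReal.ofReal γ.len ≤
        γ.integral (k j) + γ.integral (k j) * ENNReal.ofReal γ.len := by
      intro j
      have h1 := setLIntegral_mono' (μ := volume) measurableSet_Icc (hpt j)
      rw [lintegral_add_right _ measurable_const] at h1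
      simpa [Curve.integral] using h1
    have hlim2 := hlim.add (ENNReal.Tendsto.mul_const (b := ENNReal.ofReal γ.len) hlim
      (Or.inr ENNReal.ofReal_ne_top))
    have h0 := ge_of_tendsto' hlim2 hint
    simp only [zero_mul, add_zero, nonpos_iff_eq_zero, ENNReal.ofReal_eq_zero] at h0
    exact absurd γ.len_pos h0.not_gt

theorem measure_eq_zero_of_sobolevCapacity_eq_zero {Y : Type*} [MetricSpace Y]
    [MeasurableSpace Y] {p : ℝ} (hp : 1 ≤ p) {μ : Measure Y} {A : Set Y}
    (h : sobolevCapacity p μ A = 0) : μ A = 0 := by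
  refine nonpos_iff_eq_zero.1 (le_of_forall_gt fun ε hε => ?_)
  obtain ⟨u, k, huA, huk, hk, hkε⟩ := exists_test_of_sobolevCapacity_eq_zero h hε
  refine lt_of_le_of_lt ?_ hkε
  refine le_trans (measure_mono fun x hx => ?_)
    (by simpa using mul_meas_ge_le_lintegral (μ := μ) (hk.1.pow_const p) 1)
  have h1 := huk x
  rw [huA x hx] at h1
  exact ENNReal.one_le_rpow (by simpa [EReal.abs_one] using h1) (by linarith)

theorem isWeakUpperGradient_indicator_zero {p : ℝ} (hp : 1 ≤ p) {μ : Measure X} {E : Set X}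
    (h : sobolevCapacity p μ Eᶜ = 0) :
    IsWeakUpperGradient p μ (Set.indicator E fun _ => (1 : EReal)) 0 := by
  obtain ⟨ρ, hρm, hρ, hρtop⟩ := zeroModulus_endpoint_of_sobolevCapacity_eq_zero hp h
  refine ⟨measurable_zero, ρ, hρm, hρ, fun γ hγ => hρtop γ ?_⟩
  by_contra hn
  simp only [mem_ofPred_eq, mem_compl_iff, not_or, not_not] at hn
  refine hγ ?_
  have h1 : (1 : EReal) - 1 = 0 := by rw [← EReal.coe_one, ← EReal.coe_sub]; simp
  simp [UGOn, ugDiff, hn.1, hn.2, h1, EReal.abs_one]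

/-- If `C_p(X \\ E) = 0`, then the constant function `1` (extended by zero
outside `E`, i.e. the indicator of `E`) belongs to `N^{1,p}_0(E)`, and consequently
`cap_p(A,E) = 0` for every `A ⊆ E`. -/
theorem stmt_2 (p : ℝ) (hp : 1 ≤ p) (μ : Measure X)
    (hball : ∀ (x : X) (r : ℝ), 0 < r → 0 < μ (Metric.ball x r) ∧ μ (Metric.ball x r) < ⊤)
    (E : Set X) (hE : Bornology.IsBounded E)
    (h : sobolevCapacity p μ Eᶜ = 0) :
    MemNewtonian0 p μ E (Set.indicator E fun _ => (1 : EReal)) ∧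
      ∀ A : Set X, A ⊆ E → varCapacity p μ A E = 0 := by
  have hp0 : 0 < p := by linarith
  have hnull : μ Eᶜ = 0 := measure_eq_zero_of_sobolevCapacity_eq_zero hp h
  have hgrad : gradEnergy p μ (Set.indicator E fun _ => (1 : EReal)) = 0 :=
    nonpos_iff_eq_zero.1 <| (iInf₂_le 0 (isWeakUpperGradient_indicator_zero hp h)).trans_eq
      (by simp [ENNReal.zero_rpow_of_pos hp0])
  have hae : ∀ᵐ x ∂μ, x ∈ E := by simpa using measure_eq_zero_iff_ae_notMem.1 hnull
  have hEfin : μ E < ⊤ := by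
    rcases E.eq_empty_or_nonempty with rfl | ⟨x, -⟩
    · simp
    · obtain ⟨r, hr, hEr⟩ := hE.subset_ball_lt 0 x
      exact (measure_mono hEr).trans_lt (hball x r hr).2
  have huniv : μ univ < ⊤ := by
    rw [← union_compl_self E]
    exact (measure_union_le _ _).trans_lt (by simpa [hnull] using hEfin)
  have hmem : MemNewtonian0 p μ E (Set.indicator E fun _ => (1 : EReal)) := by
    refine ⟨⟨⟨fun _ => 1, measurable_const, ?_⟩, ?_⟩, fun x hx => by simp [hx]⟩
    · filter_upwards [hae] with x hx
      simp [hx]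
    · rw [newtonianEnergy, hgrad, add_zero]
      refine lt_of_eq_of_lt ?_ huniv
      rw [← lintegral_one]
      refine lintegral_congr_ae ?_
      filter_upwards [hae] with x hx
      simp [hx, EReal.abs_one]
  refine ⟨hmem, fun A hA => nonpos_iff_eq_zero.1 ?_⟩
  exact (iInf₂_le _ ⟨hmem, fun x hx => by simp [hA hx]⟩).trans_eq hgrad

end
end

section
/- Strong subadditivity of the variational capacity: for all A_1, A_2 ⊂ E, cap_p(A_1 ∪ A_2, E) + cap_p(A_1 ∩ A_2, E) ≤ cap_p(A_1, E) + cap_p(A_2, E). -/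
open MeasureTheory Metric Set Filter
open scoped ENNReal NNReal Topology

noncomputable section

variable {X : Type*} [MetricSpace X] [MeasurableSpace X] [BorelSpace X]

set_option linter.unusedSectionVars false

/-- One-step estimate used in the continuous induction of `abs_sub_le_integral_of_glue`. -/
theorem exists_step_of_glue {l : ℝ} {A B K P Q M : ℝ → ℝ} {C U : Set ℝ}
    (hA : IntegrableOn A (Icc 0 l)) (hB : IntegrableOn B (Icc 0 l))
    (hK : IntegrableOn K (Icc 0 l))
    (hP : ∀ s ∈ Icc 0 l, ∀ t ∈ Icc 0 l, s ≤ t → |P t - P s| ≤ ∫ x in s..t, A x)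
    (hQ : ∀ s ∈ Icc 0 l, ∀ t ∈ Icc 0 l, s ≤ t → |Q t - Q s| ≤ ∫ x in s..t, B x)
    (hPc : ContinuousOn P (Icc 0 l)) (hMc : ContinuousOn M (Icc 0 l))
    (hC : IsClosed C) (hU : IsOpen U) (hCU : C ⊆ U)
    (hMP : ∀ t ∈ Icc 0 l, t ∉ C → M t = P t) (hMQ : ∀ t ∈ Icc 0 l, t ∈ C → M t = Q t)
    (hAK : ∀ x ∉ C, A x ≤ K x) (hBK : ∀ x ∈ U, B x ≤ K x)
    {x y : ℝ} (hx : x ∈ Ico 0 l) (hxy : x < y) :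
    ∃ z ∈ Ioc x y, z ≤ l ∧ |M z - M x| ≤ ∫ u in x..z, K u := by
  have hxI : x ∈ Icc 0 l := Ico_subset_Icc_self hx
  have key : ∀ z, x < z → z ≤ l → ∀ F : ℝ → ℝ, IntegrableOn F (Icc 0 l) →
      (∀ u ∈ Ioo x z, F u ≤ K u) → ∫ u in x..z, F u ≤ ∫ u in x..z, K u := by
    intro z hxz hzl F hF hFK
    have hsub : uIcc x z ⊆ Icc 0 l := by
      rw [uIcc_of_le hxz.le]; exact Icc_subset_Icc hx.1 hzl
    exact intervalIntegral.integral_mono_on_of_le_Ioo hxz.le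
      (hF.mono_set hsub).intervalIntegrable (hK.mono_set hsub).intervalIntegrable hFK
  have off : ∀ z, x < z → z ≤ l → M x = P x → (∀ u ∈ Ioc x z, u ∉ C) →
      |M z - M x| ≤ ∫ u in x..z, K u := by
    intro z hxz hzl hMx hz
    have hzI : z ∈ Icc 0 l := ⟨hx.1.trans hxz.le, hzl⟩
    rw [hMx, hMP z hzI (hz z ⟨hxz, le_rfl⟩)]
    exact (hP x hxI z hzI hxz.le).trans
      (key z hxz hzl A hA fun u hu => hAK u (hz u ⟨hu.1, hu.2.le⟩))
  by_cases hxC : x ∈ C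
  · obtain ⟨d, hd, hdU⟩ := Metric.isOpen_iff.1 hU x (hCU hxC)
    obtain ⟨w, hxw, hw⟩ := exists_between (lt_min hxy (lt_min hx.2 (by linarith : x < x + d)))
    obtain ⟨hwy, hwl, hwd⟩ : w < y ∧ w < l ∧ w < x + d := by simpa using hw
    by_cases hz : ∃ z ∈ Ioc x w, z ∈ C
    · obtain ⟨z, hz, hzC⟩ := hz
      have hzI : z ∈ Icc 0 l := ⟨hx.1.trans hz.1.le, hz.2.trans hwl.le⟩
      refine ⟨z, ⟨hz.1, hz.2.trans hwy.le⟩, hzI.2, ?_⟩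
      rw [hMQ x hxI hxC, hMQ z hzI hzC]
      refine (hQ x hxI z hzI hz.1.le).trans (key z hz.1 hzI.2 B hB fun u hu => hBK u (hdU ?_))
      rw [Metric.mem_ball, Real.dist_eq, abs_of_pos (by linarith [hu.1])]
      linarith [hu.2, hz.2]
    · push Not at hz
      refine ⟨w, ⟨hxw, hwy.le⟩, hwl.le, off w hxw hwl.le ?_ hz⟩
      have hsub : Ioc x w ⊆ Icc 0 l := fun u hu => ⟨hx.1.trans hu.1.le, hu.2.trans hwl.le⟩
      have hne : (𝓝[Ioc x w] x).NeBot := by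
        rw [← mem_closure_iff_nhdsWithin_neBot, closure_Ioc hxw.ne]
        exact ⟨le_rfl, hxw.le⟩
      refine tendsto_nhds_unique ((hMc x hxI).mono_left (nhdsWithin_mono x hsub)) ?_
      refine (((hPc x hxI).mono_left (nhdsWithin_mono x hsub))).congr' ?_
      filter_upwards [self_mem_nhdsWithin] with u hu
      exact (hMP u (hsub hu) (hz u hu)).symm
  · obtain ⟨d, hd, hdC⟩ := Metric.isOpen_iff.1 hC.isOpen_compl x hxC
    obtain ⟨w, hxw, hw⟩ := exists_between (lt_min hxy (lt_min hx.2 (by linarith : x < x + d)))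
    obtain ⟨hwy, hwl, hwd⟩ : w < y ∧ w < l ∧ w < x + d := by simpa using hw
    refine ⟨w, ⟨hxw, hwy.le⟩, hwl.le, off w hxw hwl.le (hMP x hxI hxC) fun u hu => hdC ?_⟩
    rw [Metric.mem_ball, Real.dist_eq, abs_of_pos (by linarith [hu.1])]
    linarith [hu.2]

/-- If `M` agrees with `Q` on the closed set `C` and with `P` off `C`, then its increments are
controlled by integrating the bound `B` for `Q` over `C` and the bound `A` for `P` off `C`. -/
theorem abs_sub_le_integral_of_glue {l : ℝ} (hl : 0 ≤ l) {A B P Q M : ℝ → ℝ} {C : Set ℝ}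
    (hA : IntegrableOn A (Icc 0 l)) (hB : IntegrableOn B (Icc 0 l))
    (hA0 : ∀ x, 0 ≤ A x) (hB0 : ∀ x, 0 ≤ B x)
    (hP : ∀ s ∈ Icc 0 l, ∀ t ∈ Icc 0 l, s ≤ t → |P t - P s| ≤ ∫ x in s..t, A x)
    (hQ : ∀ s ∈ Icc 0 l, ∀ t ∈ Icc 0 l, s ≤ t → |Q t - Q s| ≤ ∫ x in s..t, B x)
    (hPc : ContinuousOn P (Icc 0 l)) (hMc : ContinuousOn M (Icc 0 l)) (hC : IsClosed C)
    (hMP : ∀ t ∈ Icc 0 l, t ∉ C → M t = P t) (hMQ : ∀ t ∈ Icc 0 l, t ∈ C → M t = Q t) :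
    |M l - M 0| ≤ ∫ x in Icc 0 l, (Cᶜ.indicator A x + C.indicator B x) := by
  refine le_of_forall_pos_le_add fun ε hε => ?_
  set W := volume.restrict (Icc 0 l) with hW
  have hfin : IsFiniteMeasure (W.withDensity fun x => ENNReal.ofReal (B x)) :=
    isFiniteMeasure_withDensity_ofReal hB.2
  obtain ⟨U, hCU, hU, hUC⟩ := C.exists_isOpen_lt_add
    (μ := W.withDensity fun x => ENNReal.ofReal (B x)) (measure_ne_top _ C)
    (ENNReal.ofReal_pos.2 hε).ne'
  have hdens : ∀ s : Set ℝ, MeasurableSet s → ∫ x, s.indicator B x ∂W =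
      ((W.withDensity fun x => ENNReal.ofReal (B x)) s).toReal := by
    intro s hs
    rw [integral_indicator hs, withDensity_apply _ hs,
      integral_eq_lintegral_of_nonneg_ae (Eventually.of_forall hB0) hB.1.restrict]
  have hUB : ∫ x, U.indicator B x ∂W ≤ ∫ x, C.indicator B x ∂W + ε := by
    rw [hdens U hU.measurableSet, hdens C hC.measurableSet]
    refine (ENNReal.toReal_mono (by finiteness) hUC.le).trans ?_
    rw [ENNReal.toReal_add (by finiteness) (by finiteness), ENNReal.toReal_ofReal hε.le]
  have hAi : Integrable (Cᶜ.indicator A) W := Integrable.indicator hA hC.measurableSet.compl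
  have hUi : Integrable (U.indicator B) W := Integrable.indicator hB hU.measurableSet
  have hCi : Integrable (C.indicator B) W := Integrable.indicator hB hC.measurableSet
  set K : ℝ → ℝ := fun x => Cᶜ.indicator A x + U.indicator B x with hKdef
  have hK : IntegrableOn K (Icc 0 l) := hAi.add hUi
  have hAK : ∀ x ∉ C, A x ≤ K x := fun x hx => by
    simpa [hKdef, hx] using indicator_nonneg (fun y _ => hB0 y) x
  have hBK : ∀ x ∈ U, B x ≤ K x := fun x hx => by
    simpa [hKdef, hx] using indicator_nonneg (fun y _ => hA0 y) x
  have hmain : Icc 0 l ⊆ {t | |M t - M 0| ≤ ∫ x in (0 : ℝ)..t, K x} := by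
    refine IsClosed.Icc_subset_of_forall_exists_gt ?_ (by simp) ?_
    · have hc : ContinuousOn (fun t => ∫ x in (0 : ℝ)..t, K x) (Icc 0 l) := by
        have := intervalIntegral.continuousOn_primitive_interval (μ := volume) (f := K)
          (a := 0) (b := l) (by rwa [uIcc_of_le hl])
        rwa [uIcc_of_le hl] at this
      have := isClosed_Icc.isClosed_le (hMc.sub (continuousOn_const (c := M 0))).abs hc
      rwa [inter_comm]
    · rintro x ⟨hxS, hx⟩ y hxy
      obtain ⟨z, hz, hzl, hzM⟩ := exists_step_of_glue hA hB hK hP hQ hPc hMc hC hU hCU hMP hMQ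
        hAK hBK hx hxy
      refine ⟨z, ?_, hz⟩
      have h1 : IntervalIntegrable K volume 0 x := by
        refine (hK.mono_set ?_).intervalIntegrable
        rw [uIcc_of_le hx.1]; exact Icc_subset_Icc le_rfl hx.2.le
      have h2 : IntervalIntegrable K volume x z := by
        refine (hK.mono_set ?_).intervalIntegrable
        rw [uIcc_of_le hz.1.le]; exact Icc_subset_Icc hx.1 hzl
      simp only [mem_ofPred_eq] at hxS ⊢
      rw [← intervalIntegral.integral_add_adjacent_intervals h1 h2]
      calc |M z - M 0| ≤ |M z - M x| + |M x - M 0| := abs_sub_le _ _ _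
        _ ≤ _ := by linarith
  have hend : |M l - M 0| ≤ ∫ x in (0 : ℝ)..l, K x := hmain ⟨hl, le_rfl⟩
  rw [intervalIntegral.integral_of_le hl, ← integral_Icc_eq_integral_Ioc, ← hW,
    integral_add hAi hUi] at hend
  rw [integral_add hAi hCi]
  linarith

theorem Curve.continuousOn_shift (γ : Curve X) {s t : ℝ} (hs : 0 ≤ s) (ht : t ≤ γ.len) :
    ContinuousOn (fun τ => γ.toFun (s + τ)) (Icc 0 (t - s)) :=
  γ.continuousOn.comp (by fun_prop)
    fun τ hτ => ⟨by linarith [hτ.1], by linarith [hτ.2]⟩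

/-- The restriction of a curve to a nondegenerate subinterval. -/
def Curve.restrict (γ : Curve X) (s t : ℝ) (hs : 0 ≤ s) (hst : s < t) (ht : t ≤ γ.len) :
    Curve X where
  len := t - s
  len_pos := sub_pos.2 hst
  toFun τ := γ.toFun (s + τ)
  continuousOn := γ.continuousOn_shift hs ht
  arclength a b ha hb hab := by
    have h := eVariationOn.comp_eq_of_monotoneOn γ.toFun (t := Icc a b) (fun τ => s + τ)
      fun _ _ _ _ h => by simpa using h
    rw [image_const_add_Icc] at h
    refine h.trans ((γ.arclength (s + a) (s + b) ?_ ?_ ?_).trans ?_)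
    · exact ⟨by linarith [ha.1], by linarith [ha.2]⟩
    · exact ⟨by linarith [hb.1], by linarith [hb.2]⟩
    · linarith
    · congr 1; ring
  nonconstant := by
    by_contra! hcon
    have h0 : eVariationOn γ.toFun (Icc s t) = 0 := by
      rw [eVariationOn.eq_zero_iff]
      intro x hx y hy
      have := hcon (x - s) ⟨by linarith [hx.1], by linarith [hx.2]⟩ (y - s)
        ⟨by linarith [hy.1], by linarith [hy.2]⟩
      simp only [add_sub_cancel] at this
      rw [this, edist_self]
    rw [γ.arclength s t ⟨hs, by linarith⟩ ⟨by linarith, ht⟩ hst.le, ENNReal.ofReal_eq_zero] at h0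
    linarith

theorem Curve.integral_restrict (γ : Curve X) (g : X → ℝ≥0∞) {s t : ℝ} (hs : 0 ≤ s) (hst : s < t)
    (ht : t ≤ γ.len) :
    (γ.restrict s t hs hst ht).integral g = ∫⁻ x in Icc s t, g (γ.toFun x) := by
  have h := (measurePreserving_add_left volume s).setLIntegral_comp_preimage_emb
    (measurableEmbedding_addLeft s) (fun x => g (γ.toFun x)) (Icc s t)
  rw [preimage_const_add_Icc, sub_self] at h
  exact h

theorem Curve.ugOn_restrict_iff (γ : Curve X) (f : X → EReal) (g : X → ℝ≥0∞) {s t : ℝ}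
    (hs : 0 ≤ s) (hst : s < t) (ht : t ≤ γ.len) :
    UGOn f g (γ.restrict s t hs hst ht) ↔
      ugDiff (f (γ.toFun s)) (f (γ.toFun t)) ≤ ∫⁻ x in Icc s t, g (γ.toFun x) := by
  rw [UGOn, γ.integral_restrict g hs hst ht]
  simp [Curve.restrict]

theorem Curve.integral_mono (γ : Curve X) {g h : X → ℝ≥0∞} (hgh : ∀ x, g x ≤ h x) :
    γ.integral g ≤ γ.integral h :=
  lintegral_mono fun _ => hgh _

theorem Curve.aemeasurable (γ : Curve X) :
    AEMeasurable γ.toFun (volume.restrict (Icc 0 γ.len)) :=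
  γ.continuousOn.aemeasurable measurableSet_Icc

theorem ZeroModulus.mono {p : ℝ} {μ : Measure X} {Γ Γ' : Set (Curve X)} (h : ZeroModulus p μ Γ')
    (hsub : Γ ⊆ Γ') : ZeroModulus p μ Γ := by
  obtain ⟨ρ, hρ, hfin, htop⟩ := h
  exact ⟨ρ, hρ, hfin, fun γ hγ => htop γ (hsub hγ)⟩

theorem ZeroModulus.union {p : ℝ} {μ : Measure X} {Γ Γ' : Set (Curve X)}
    (h : ZeroModulus p μ Γ) (h' : ZeroModulus p μ Γ') : ZeroModulus p μ (Γ ∪ Γ') := by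
  obtain ⟨ρ, hρ, hfin, htop⟩ := h
  obtain ⟨ρ', hρ', hfin', htop'⟩ := h'
  refine ⟨fun x => max (ρ x) (ρ' x), hρ.max hρ', ?_, ?_⟩
  · calc ∫⁻ x, max (ρ x) (ρ' x) ^ p ∂μ ≤ ∫⁻ x, (ρ x ^ p + ρ' x ^ p) ∂μ := by
          refine lintegral_mono fun x => ?_
          rcases max_choice (ρ x) (ρ' x) with h | h <;> simp [h]
      _ = ∫⁻ x, ρ x ^ p ∂μ + ∫⁻ x, ρ' x ^ p ∂μ := lintegral_add_left (hρ.pow_const p) _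
      _ < ⊤ := ENNReal.add_lt_top.2 ⟨hfin, hfin'⟩
  · rintro γ (hγ | hγ)
    · exact top_unique ((htop γ hγ).symm.le.trans (γ.integral_mono fun x => le_max_left _ _))
    · exact top_unique ((htop' γ hγ).symm.le.trans (γ.integral_mono fun x => le_max_right _ _))

/-- Almost every curve has all its subcurves outside a given family of zero modulus. -/
theorem ZeroModulus.of_restrict {p : ℝ} {μ : Measure X} {Γ : Set (Curve X)}
    (h : ZeroModulus p μ Γ) :
    ZeroModulus p μ {γ : Curve X | ∃ (s t : ℝ) (hs : 0 ≤ s) (hst : s < t) (ht : t ≤ γ.len),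
      γ.restrict s t hs hst ht ∈ Γ} := by
  obtain ⟨ρ, hρ, hfin, htop⟩ := h
  refine ⟨ρ, hρ, hfin, ?_⟩
  rintro γ ⟨s, t, hs, hst, ht, hγ⟩
  have h := htop _ hγ
  rw [γ.integral_restrict] at h
  exact top_unique (h.symm.le.trans (lintegral_mono_set (Icc_subset_Icc hs ht)))

/-- Almost every curve meets a given null set in a set of zero length. -/
theorem zeroModulus_null {p : ℝ} (hp : 0 < p) {μ : Measure X} {N : Set X} (hN : MeasurableSet N)
    (hN0 : μ N = 0) :
    ZeroModulus p μ {γ : Curve X |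
      ¬ ∀ᵐ t ∂(volume.restrict (Icc 0 γ.len)), γ.toFun t ∉ N} := by
  have hm : Measurable (N.indicator fun _ => (⊤ : ℝ≥0∞)) := measurable_const.indicator hN
  refine ⟨_, hm, ?_, fun γ hγ => ?_⟩
  · have hae : ∀ᵐ x ∂μ, N.indicator (fun _ => (⊤ : ℝ≥0∞)) x ^ p = 0 := by
      filter_upwards [measure_eq_zero_iff_ae_notMem.1 hN0] with x hx
      simp [hx, hp]
    rw [lintegral_congr_ae hae]
    simp
  · by_contra hfin
    refine hγ ?_
    filter_upwards [ae_lt_top' (hm.comp_aemeasurable γ.aemeasurable) hfin] with t ht htN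
    simp [htN] at ht

theorem abs_ne_top_left_of_ugDiff_ne_top {a b : EReal} (h : ugDiff a b ≠ ⊤) : a.abs ≠ ⊤ := by
  intro ha; simp [ugDiff, ha] at h

theorem abs_ne_top_right_of_ugDiff_ne_top {a b : EReal} (h : ugDiff a b ≠ ⊤) : b.abs ≠ ⊤ := by
  intro hb; simp [ugDiff, hb] at h

theorem ugDiff_coe (a b : ℝ) : ugDiff (a : EReal) (b : EReal) = ENNReal.ofReal |a - b| := by
  rw [ugDiff, if_neg (by simp [(EReal.abs_coe_lt_top _).ne]), ← EReal.coe_sub, EReal.abs_def]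

theorem coe_toReal_of_abs_ne_top {a : EReal} (h : a.abs ≠ ⊤) : (a.toReal : EReal) = a := by
  refine EReal.coe_toReal ?_ ?_ <;> rintro rfl <;> simp at h

/-- `f` is real-valued along `γ`, with increments controlled by the integral of `g`, which is
finite. -/
def UGAlong (f : X → EReal) (g : X → ℝ≥0∞) (γ : Curve X) : Prop :=
  ∃ F : ℝ → ℝ, (∀ t ∈ Icc 0 γ.len, f (γ.toFun t) = F t) ∧
    IntegrableOn (fun x => (g (γ.toFun x)).toReal) (Icc 0 γ.len) ∧
    ContinuousOn F (Icc 0 γ.len) ∧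
    ∀ s ∈ Icc 0 γ.len, ∀ t ∈ Icc 0 γ.len, s ≤ t →
      |F t - F s| ≤ ∫ x in s..t, (g (γ.toFun x)).toReal

theorem continuousOn_of_abs_sub_le_integral {l : ℝ} (hl : 0 ≤ l) {F A : ℝ → ℝ}
    (hA : IntegrableOn A (Icc 0 l))
    (hF : ∀ s ∈ Icc 0 l, ∀ t ∈ Icc 0 l, s ≤ t → |F t - F s| ≤ ∫ x in s..t, A x) :
    ContinuousOn F (Icc 0 l) := by
  have hc : ContinuousOn (fun t => ∫ x in (0 : ℝ)..t, A x) (Icc 0 l) := by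
    have := intervalIntegral.continuousOn_primitive_interval (μ := volume) (f := A)
      (a := 0) (b := l) (by rwa [uIcc_of_le hl])
    rwa [uIcc_of_le hl] at this
  have hsub : ∀ s ∈ Icc 0 l, ∀ t ∈ Icc 0 l, s ≤ t →
      |F t - F s| ≤ |(∫ x in (0 : ℝ)..t, A x) - ∫ x in (0 : ℝ)..s, A x| := by
    intro s hs t ht hst
    have hi : ∀ r ∈ Icc 0 l, IntervalIntegrable A volume 0 r := fun r hr => by
      refine (hA.mono_set ?_).intervalIntegrable
      rw [uIcc_of_le hr.1]; exact Icc_subset_Icc le_rfl hr.2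
    rw [intervalIntegral.integral_interval_sub_left (hi t ht) (hi s hs)]
    exact (hF s hs t ht hst).trans (le_abs_self _)
  intro s hs
  rw [ContinuousWithinAt, tendsto_iff_dist_tendsto_zero]
  have hG := tendsto_iff_dist_tendsto_zero.1 (hc s hs)
  refine squeeze_zero' (Eventually.of_forall fun _ => dist_nonneg) ?_ hG
  filter_upwards [self_mem_nhdsWithin] with t ht
  rcases le_total s t with h | h
  · exact hsub s hs t ht h
  · rw [dist_comm (F t), dist_comm (∫ x in (0 : ℝ)..t, A x)]
    exact hsub t ht s hs h

theorem UGAlong.of_restrict {f : X → EReal} {g : X → ℝ≥0∞} (hg : Measurable g) {γ : Curve X}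
    (hfin : γ.integral g ≠ ⊤)
    (h : ∀ (s t : ℝ) (hs : 0 ≤ s) (hst : s < t) (ht : t ≤ γ.len),
      UGOn f g (γ.restrict s t hs hst ht)) : UGAlong f g γ := by
  have hgm : AEMeasurable (fun x => g (γ.toFun x)) (volume.restrict (Icc 0 γ.len)) :=
    hg.comp_aemeasurable γ.aemeasurable
  have hint : IntegrableOn (fun x => (g (γ.toFun x)).toReal) (Icc 0 γ.len) :=
    integrable_toReal_of_lintegral_ne_top hgm hfin
  have hne : ∀ s t : ℝ, 0 ≤ s → t ≤ γ.len → ∫⁻ x in Icc s t, g (γ.toFun x) ≠ ⊤ :=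
    fun s t hs ht => ne_top_of_le_ne_top hfin (lintegral_mono_set (Icc_subset_Icc hs ht))
  simp only [γ.ugOn_restrict_iff] at h
  have hreal : ∀ t ∈ Icc 0 γ.len, (f (γ.toFun t)).abs ≠ ⊤ := by
    intro t ht
    rcases ht.1.eq_or_lt with h0 | h0
    · exact abs_ne_top_left_of_ugDiff_ne_top (ne_top_of_le_ne_top (hne t γ.len ht.1 le_rfl)
        (h t γ.len ht.1 (h0 ▸ γ.len_pos) le_rfl))
    · exact abs_ne_top_right_of_ugDiff_ne_top (ne_top_of_le_ne_top (hne 0 t le_rfl ht.2)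
        (h 0 t le_rfl h0 ht.2))
  have hcoe : ∀ t ∈ Icc 0 γ.len, f (γ.toFun t) = ((f (γ.toFun t)).toReal : EReal) :=
    fun t ht => (coe_toReal_of_abs_ne_top (hreal t ht)).symm
  have hinc : ∀ s ∈ Icc 0 γ.len, ∀ t ∈ Icc 0 γ.len, s ≤ t →
      |(f (γ.toFun t)).toReal - (f (γ.toFun s)).toReal| ≤
        ∫ x in s..t, (g (γ.toFun x)).toReal := by
    intro s hs t ht hst
    rcases hst.eq_or_lt with rfl | hst'
    · simp
    have hd := h s t hs.1 hst' ht.2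
    rw [hcoe s hs, hcoe t ht, ugDiff_coe] at hd
    have hm : AEMeasurable (fun x => g (γ.toFun x)) (volume.restrict (Icc s t)) :=
      hgm.mono_measure (Measure.restrict_mono (Icc_subset_Icc hs.1 ht.2) le_rfl)
    rw [intervalIntegral.integral_of_le hst, ← integral_Icc_eq_integral_Ioc,
      integral_toReal hm (ae_lt_top' hm (hne s t hs.1 ht.2)), abs_sub_comm]
    exact (ENNReal.ofReal_le_iff_le_toReal (hne s t hs.1 ht.2)).1 hd
  exact ⟨fun t => (f (γ.toFun t)).toReal, hcoe, hint,
    continuousOn_of_abs_sub_le_integral γ.len_pos.le hint hinc, hinc⟩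

/-- Upper gradient inequality for a function glued from `P` (off `C`) and `Q` (on `C`). -/
theorem ugOn_of_glue {P Q M : X → EReal} {a b : X → ℝ≥0∞} {γ : Curve X} {D : Set X}
    [DecidablePred (· ∈ D)] {C : Set ℝ} (hC : IsClosed C) (hP : UGAlong P a γ) (hQ : UGAlong Q b γ) {m : ℝ → ℝ}
    (hM : ∀ t ∈ Icc 0 γ.len, M (γ.toFun t) = m t) (hm : ContinuousOn m (Icc 0 γ.len))
    (hMP : ∀ t ∈ Icc 0 γ.len, t ∉ C → M (γ.toFun t) = P (γ.toFun t))
    (hMQ : ∀ t ∈ Icc 0 γ.len, t ∈ C → M (γ.toFun t) = Q (γ.toFun t))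
    (hD : ∀ᵐ t ∂(volume.restrict (Icc 0 γ.len)), γ.toFun t ∈ D ↔ t ∉ C) :
    UGOn M (D.piecewise a b) γ := by
  obtain ⟨F, hF, hFi, hFc, hFd⟩ := hP
  obtain ⟨G, hG, hGi, hGc, hGd⟩ := hQ
  have h := abs_sub_le_integral_of_glue γ.len_pos.le hFi hGi (fun _ => ENNReal.toReal_nonneg)
    (fun _ => ENNReal.toReal_nonneg) hFd hGd hFc hm hC
    (fun t ht htC => by exact_mod_cast (hM t ht).symm.trans ((hMP t ht htC).trans (hF t ht)))
    (fun t ht htC => by exact_mod_cast (hM t ht).symm.trans ((hMQ t ht htC).trans (hG t ht)))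
  rw [UGOn, hM 0 ⟨le_rfl, γ.len_pos.le⟩, hM γ.len ⟨γ.len_pos.le, le_rfl⟩, ugDiff_coe,
    abs_sub_comm]
  refine (ENNReal.ofReal_le_ofReal h).trans ?_
  rw [ofReal_integral_eq_lintegral_ofReal]
  · refine lintegral_mono_ae ?_
    filter_upwards [hD] with t ht
    by_cases htC : t ∈ C
    · have : γ.toFun t ∉ D := fun h => ht.1 h htC
      simpa [htC, this] using ENNReal.ofReal_toReal_le
    · have : γ.toFun t ∈ D := ht.2 htC
      simpa [htC, this] using ENNReal.ofReal_toReal_le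
  · exact (Integrable.indicator hFi hC.measurableSet.compl).add
      (Integrable.indicator hGi hC.measurableSet)
  · exact Eventually.of_forall fun t => add_nonneg
      (indicator_nonneg (fun _ _ => ENNReal.toReal_nonneg) _)
      (indicator_nonneg (fun _ _ => ENNReal.toReal_nonneg) _)

/-- Almost every curve carries the upper gradient inequality for a given weak upper gradient of
finite energy on all of its subcurves. -/
theorem IsWeakUpperGradient.zeroModulus_not_ugAlong {p : ℝ} {μ : Measure X} {f : X → EReal}
    {g : X → ℝ≥0∞} (h : IsWeakUpperGradient p μ f g) (hg : ∫⁻ x, g x ^ p ∂μ < ⊤) :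
    ZeroModulus p μ {γ : Curve X | ¬ UGAlong f g γ} := by
  have htop : ZeroModulus p μ {γ : Curve X | γ.integral g = ⊤} := ⟨g, h.1, hg, fun _ hγ => hγ⟩
  refine (h.2.of_restrict.union htop).mono fun γ hγ => ?_
  by_contra hcon
  simp only [mem_union, mem_ofPred_eq, not_or, not_exists, not_not] at hcon
  exact hγ (UGAlong.of_restrict h.1 hcon.2 hcon.1)

/-- Along a curve, gluing the bounds for `u` and `v` according to which one is larger gives the
upper gradient inequality for `max u v` and `min u v`. -/
theorem ugOn_max_min {u v : X → EReal} {a b : X → ℝ≥0∞} {γ : Curve X} {D : Set X}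
    [DecidablePred (· ∈ D)] (hu : UGAlong u a γ) (hv : UGAlong v b γ)
    (hD : ∀ᵐ t ∂(volume.restrict (Icc 0 γ.len)),
      γ.toFun t ∈ D ↔ v (γ.toFun t) < u (γ.toFun t)) :
    UGOn (fun x => max (u x) (v x)) (D.piecewise a b) γ ∧
      UGOn (fun x => min (u x) (v x)) (D.piecewise b a) γ := by
  obtain ⟨F, hF, -, hFc, -⟩ := id hu
  obtain ⟨G, hG, -, hGc, -⟩ := id hv
  have hC : IsClosed {t ∈ Icc 0 γ.len | F t ≤ G t} := isClosed_Icc.isClosed_le hFc hGc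
  have hmem : ∀ t ∈ Icc 0 γ.len,
      (t ∈ {t ∈ Icc 0 γ.len | F t ≤ G t} ↔ u (γ.toFun t) ≤ v (γ.toFun t)) := by
    intro t ht
    rw [hF t ht, hG t ht, EReal.coe_le_coe_iff]
    exact ⟨fun h => h.2, fun h => ⟨ht, h⟩⟩
  have hD' : ∀ᵐ t ∂(volume.restrict (Icc 0 γ.len)),
      γ.toFun t ∈ D ↔ t ∉ {t ∈ Icc 0 γ.len | F t ≤ G t} := by
    filter_upwards [hD, ae_restrict_mem measurableSet_Icc] with t ht htI
    exact ht.trans (not_le.symm.trans (hmem t htI).not.symm)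
  constructor
  · refine ugOn_of_glue hC hu hv (m := fun t => max (F t) (G t)) (fun t ht => ?_)
      (hFc.sup hGc) (fun t ht htC => ?_) (fun t ht htC => ?_) hD'
    · simp only [hF t ht, hG t ht]
      exact (EReal.coe_strictMono.monotone.map_max).symm
    · rw [hmem t ht, not_le] at htC
      exact max_eq_left htC.le
    · rw [hmem t ht] at htC
      exact max_eq_right htC
  · refine ugOn_of_glue hC hv hu (m := fun t => min (F t) (G t)) (fun t ht => ?_)
      (hFc.inf hGc) (fun t ht htC => ?_) (fun t ht htC => ?_) hD'
    · simp only [hF t ht, hG t ht]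
      exact (EReal.coe_strictMono.monotone.map_min).symm
    · rw [hmem t ht, not_le] at htC
      exact min_eq_right htC.le
    · rw [hmem t ht] at htC
      exact min_eq_left htC

/-- The gradient energy is submodular. -/
theorem gradEnergy_max_add_gradEnergy_min_le {p : ℝ} (hp : 0 < p) {μ : Measure X}
    {u v : X → EReal} (hu : AEMeasurable u μ) (hv : AEMeasurable v μ) :
    gradEnergy p μ (fun x => max (u x) (v x)) + gradEnergy p μ (fun x => min (u x) (v x)) ≤
      gradEnergy p μ u + gradEnergy p μ v := by
  classical
  conv_rhs => simp only [gradEnergy, ENNReal.iInf_add, ENNReal.add_iInf]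
  refine le_iInf₂ fun b hb => le_iInf₂ fun a ha => ?_
  by_cases hfin : ∫⁻ x, a x ^ p ∂μ + ∫⁻ x, b x ^ p ∂μ = ⊤
  · rw [hfin]; exact le_top
  obtain ⟨hafin, hbfin⟩ := ENNReal.add_lt_top.1 (lt_top_iff_ne_top.2 hfin)
  set D : Set X := {x | hv.mk v x < hu.mk u x}
  have hD : MeasurableSet D := measurableSet_lt hv.measurable_mk hu.measurable_mk
  have hbad : μ {x | ¬ (u x = hu.mk u x ∧ v x = hv.mk v x)} = 0 :=
    ae_iff.1 (hu.ae_eq_mk.and hv.ae_eq_mk)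
  obtain ⟨N, hsub, hN, hN0⟩ := exists_measurable_superset_of_null hbad
  have hmod := ((ha.zeroModulus_not_ugAlong hafin).union
    (hb.zeroModulus_not_ugAlong hbfin)).union (zeroModulus_null hp hN hN0)
  have hgood : ∀ γ : Curve X, γ ∉ ({γ : Curve X | ¬ UGAlong u a γ} ∪
      {γ : Curve X | ¬ UGAlong v b γ} ∪ {γ : Curve X |
        ¬ ∀ᵐ t ∂(volume.restrict (Icc 0 γ.len)), γ.toFun t ∉ N}) →
      UGOn (fun x => max (u x) (v x)) (D.piecewise a b) γ ∧
        UGOn (fun x => min (u x) (v x)) (D.piecewise b a) γ := by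
    intro γ hγ
    simp only [mem_union, mem_ofPred_eq, not_or, not_not] at hγ
    refine ugOn_max_min hγ.1.1 hγ.1.2 ?_
    filter_upwards [hγ.2] with t ht
    obtain ⟨h1, h2⟩ := not_not.1 fun h => ht (hsub h)
    rw [h1, h2]
    rfl
  have hmax : IsWeakUpperGradient p μ (fun x => max (u x) (v x)) (D.piecewise a b) :=
    ⟨ha.1.piecewise hD hb.1, hmod.mono fun γ hγ => by_contra fun h => hγ (hgood γ h).1⟩
  have hmin : IsWeakUpperGradient p μ (fun x => min (u x) (v x)) (D.piecewise b a) :=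
    ⟨hb.1.piecewise hD ha.1, hmod.mono fun γ hγ => by_contra fun h => hγ (hgood γ h).2⟩
  calc _ ≤ ∫⁻ x, D.piecewise a b x ^ p ∂μ + ∫⁻ x, D.piecewise b a x ^ p ∂μ :=
        add_le_add (iInf₂_le _ hmax) (iInf₂_le _ hmin)
    _ = ∫⁻ x, (D.piecewise a b x ^ p + D.piecewise b a x ^ p) ∂μ :=
        (lintegral_add_left (hmax.1.pow_const p) _).symm
    _ = ∫⁻ x, (a x ^ p + b x ^ p) ∂μ := by
        refine lintegral_congr fun x => ?_
        by_cases hx : x ∈ D <;> simp [hx, add_comm]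
    _ = _ := lintegral_add_left (ha.1.pow_const p) _

theorem lintegral_abs_rpow_lt_top_of_choice {p : ℝ} {μ : Measure X} {u v w : X → EReal}
    (hu : AEMeasurable u μ) (hw : ∀ x, w x = u x ∨ w x = v x)
    (hufin : ∫⁻ x, (u x).abs ^ p ∂μ < ⊤) (hvfin : ∫⁻ x, (v x).abs ^ p ∂μ < ⊤) :
    ∫⁻ x, (w x).abs ^ p ∂μ < ⊤ := by
  calc ∫⁻ x, (w x).abs ^ p ∂μ ≤ ∫⁻ x, ((u x).abs ^ p + (v x).abs ^ p) ∂μ := by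
        refine lintegral_mono fun x => ?_
        rcases hw x with h | h <;> simp [h]
    _ = ∫⁻ x, (u x).abs ^ p ∂μ + ∫⁻ x, (v x).abs ^ p ∂μ :=
        lintegral_add_left' ((EReal.measurable_abs.comp_aemeasurable hu).pow_const p) _
    _ < ⊤ := ENNReal.add_lt_top.2 ⟨hufin, hvfin⟩

theorem MemNewtonian0.max_min {p : ℝ} (hp : 0 < p) {μ : Measure X} {E : Set X} {u v : X → EReal}
    (hu : MemNewtonian0 p μ E u) (hv : MemNewtonian0 p μ E v) :
    MemNewtonian0 p μ E (fun x => max (u x) (v x)) ∧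
      MemNewtonian0 p μ E (fun x => min (u x) (v x)) := by
  obtain ⟨⟨hum, hufin⟩, hu0⟩ := hu
  obtain ⟨⟨hvm, hvfin⟩, hv0⟩ := hv
  obtain ⟨hu1, hu2⟩ := ENNReal.add_lt_top.1 hufin
  obtain ⟨hv1, hv2⟩ := ENNReal.add_lt_top.1 hvfin
  obtain ⟨hmax, hmin⟩ := ENNReal.add_lt_top.1 ((gradEnergy_max_add_gradEnergy_min_le hp hum
    hvm).trans_lt (ENNReal.add_lt_top.2 ⟨hu2, hv2⟩))
  refine ⟨⟨⟨hum.max hvm, ENNReal.add_lt_top.2 ⟨?_, hmax⟩⟩, fun x hx => ?_⟩,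
    ⟨⟨hum.min hvm, ENNReal.add_lt_top.2 ⟨?_, hmin⟩⟩, fun x hx => ?_⟩⟩
  · exact lintegral_abs_rpow_lt_top_of_choice hum (fun x => max_choice _ _) hu1 hv1
  · simp [hu0 x hx, hv0 x hx]
  · exact lintegral_abs_rpow_lt_top_of_choice hum (fun x => min_choice _ _) hu1 hv1
  · simp [hu0 x hx, hv0 x hx]

/-- Strong subadditivity. -/
theorem stmt_5 (p : ℝ) (hp : 1 ≤ p) (μ : Measure X)
    (hball : ∀ (x : X) (r : ℝ), 0 < r → 0 < μ (Metric.ball x r) ∧ μ (Metric.ball x r) < ⊤)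
    (E : Set X) (hE : Bornology.IsBounded E)
    (A₁ A₂ : Set X) (h1 : A₁ ⊆ E) (h2 : A₂ ⊆ E) :
    varCapacity p μ (A₁ ∪ A₂) E + varCapacity p μ (A₁ ∩ A₂) E ≤
      varCapacity p μ A₁ E + varCapacity p μ A₂ E := by
  have hp0 : 0 < p := zero_lt_one.trans_le hp
  conv_rhs => simp only [varCapacity, ENNReal.iInf_add, ENNReal.add_iInf]
  refine le_iInf₂ fun v hv => le_iInf₂ fun u hu => ?_
  obtain ⟨hmax, hmin⟩ := hu.1.max_min hp0 hv.1
  refine le_trans (add_le_add (iInf₂_le _ ⟨hmax, fun x hx => ?_⟩)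
    (iInf₂_le _ ⟨hmin, fun x hx => ?_⟩))
    (gradEnergy_max_add_gradEnergy_min_le hp0 hu.1.1.1 hv.1.1.1)
  · exact le_max_iff.2 (hx.imp (hu.2 x) (hv.2 x))
  · exact le_min (hu.2 x hx.1) (hv.2 x hx.2)

end
end
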